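/- The language of irreducible Motzkin words — words over {u, d, x} of length ≥ 2, of total height 0, all of whose proper nonempty prefixes have height ≥ 1 — over the alphabet {u, d, x} with involution u* = d, x* = x is a Pythagorean language. -/

import Mathlib

/-- The involution on words induced by an involution `s` on letters. -/
def wordStar {G : Type*} (s : G → G) (w : List G) : List G :=
  (w.map s).reverse

/-- A language is self-adjoint if it is closed under the word involution. -/
def IsSelfAdjointLang {G : Type*} (s : G → G) (L : Set (List G)) : Prop :=
  ∀ w ∈ L, wordStar s w ∈ L

/-- A self-adjoint language `L` is Pythagorean if for all nonempty words `α, β, γ`: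
whenever `β*α` and `γ*α` lie in `L`, then `α*α` and `γ*β` lie in `L`. -/
def IsPythagorean {G : Type*} (s : G → G) (L : Set (List G)) : Prop :=
  IsSelfAdjointLang s L ∧
    ∀ α β γ : List G, α ≠ [] → β ≠ [] → γ ≠ [] →
      wordStar s β ++ α ∈ L → wordStar s γ ++ α ∈ L →
      wordStar s α ++ α ∈ L ∧ wordStar s γ ++ β ∈ L

/-- The three-letter alphabet `{u, d, x}`. -/
inductive MLetter : Type
  | u : MLetter
  | d : MLetter
  | x : MLetter

/-- The involution `u* = d`, `d* = u`, `x* = x`. -/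
def mstar : MLetter → MLetter
  | .u => .d
  | .d => .u
  | .x => .x

/-- Heights of letters: `u ↦ +1`, `d ↦ -1`, `x ↦ 0`. -/
def mheight : MLetter → ℤ
  | .u => 1
  | .d => -1
  | .x => 0

/-- The height of a word is the sum of the heights of its letters. -/
def mht (w : List MLetter) : ℤ := (w.map mheight).sum

/-- Irreducible Motzkin words: words of length at least `2`, of total height `0`,
all of whose proper nonempty prefixes have height `≥ 1`. -/
def IrrMotzkinLang : Set (List MLetter) :=
  {w | 2 ≤ w.length ∧ mht w = 0 ∧
    ∀ p : List MLetter, p <+: w → p ≠ [] → p ≠ w → 1 ≤ mht p}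

theorem mht_append (v w : List MLetter) : mht (v ++ w) = mht v + mht w := by
  simp [mht]

theorem mht_wordStar (w : List MLetter) : mht (wordStar mstar w) = -mht w := by
  induction w with
  | nil => rfl
  | cons a w ih =>
    have hw : wordStar mstar (a :: w) = wordStar mstar w ++ [mstar a] := by simp [wordStar]
    have ha : mht [mstar a] = -mht [a] := by cases a <;> rfl
    have hc : mht (a :: w) = mht [a] + mht w := mht_append [a] w
    rw [hw, mht_append, ih, ha, hc]
    ring

theorem wordStar_append {G : Type*} (s : G → G) (v w : List G) :
    wordStar s (v ++ w) = wordStar s w ++ wordStar s v := by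
  simp [wordStar]

theorem wordStar_eq_nil {G : Type*} {s : G → G} {w : List G} : wordStar s w = [] ↔ w = [] := by
  simp [wordStar]

theorem mstar_involutive : Function.Involutive mstar := by
  intro a
  cases a <;> rfl

theorem wordStar_wordStar {G : Type*} {s : G → G} (hs : Function.Involutive s) (w : List G) :
    wordStar s (wordStar s w) = w := by
  simp [wordStar, hs.comp_self]

theorem mem_irrMotzkinLang_iff {w : List MLetter} :
    w ∈ IrrMotzkinLang ↔ 2 ≤ w.length ∧ mht w = 0 ∧
      ∀ p q : List MLetter, p ++ q = w → p ≠ [] → q ≠ [] → 1 ≤ mht p := by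
  refine and_congr_right fun _ => and_congr_right fun _ => ⟨fun h p q hw hp hq => ?_, ?_⟩
  · refine h p ⟨q, hw⟩ hp ?_
    rintro rfl
    exact hq (by simpa using hw)
  · rintro h p ⟨q, hw⟩ hp hne
    refine h p q hw hp ?_
    rintro rfl
    exact hne (by simpa using hw)

/-- A product `β*α` of nonempty words is irreducible exactly when `α` and `β` have equal height
and all their nonempty suffixes have negative height. -/
theorem wordStar_append_mem_irrMotzkinLang_iff {α β : List MLetter} (hα : α ≠ []) (hβ : β ≠ []) :
    wordStar mstar β ++ α ∈ IrrMotzkinLang ↔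
      mht α = mht β ∧ (∀ t, t <:+ α → t ≠ [] → mht t ≤ -1) ∧
        ∀ t, t <:+ β → t ≠ [] → mht t ≤ -1 := by
  rw [mem_irrMotzkinLang_iff, mht_append, mht_wordStar]
  constructor
  · rintro ⟨-, h0, h⟩
    have hβs : ∀ t, t <:+ β → t ≠ [] → mht t ≤ -1 := by
      rintro t ⟨r, rfl⟩ ht
      have := h (wordStar mstar t) (wordStar mstar r ++ α) (by simp [wordStar_append])
        (by simpa [wordStar_eq_nil] using ht) (by simp [hα])
      rw [mht_wordStar] at this
      linarith
    refine ⟨by linarith, ?_, hβs⟩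
    rintro t ⟨r, rfl⟩ ht
    have := h (wordStar mstar β ++ r) t (by simp) (by simp [wordStar_eq_nil, hβ]) ht
    rw [mht_append, mht_wordStar] at this
    rw [mht_append] at h0
    linarith
  · rintro ⟨h0, hαs, hβs⟩
    refine ⟨?_, by linarith, fun p q hpq hp hq => ?_⟩
    · have h1 := List.length_pos_of_ne_nil hα
      have h2 := List.length_pos_of_ne_nil hβ
      simp only [wordStar, List.length_append, List.length_reverse, List.length_map]
      omega
    · rcases List.append_eq_append_iff.1 hpq with ⟨r, hr, -⟩ | ⟨r, rfl, rfl⟩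
      · have hβ' : wordStar mstar r ++ wordStar mstar p = β := by
          rw [← wordStar_append, ← hr, wordStar_wordStar mstar_involutive]
        have := hβs _ ⟨_, hβ'⟩ (by simpa [wordStar_eq_nil] using hp)
        rw [mht_wordStar] at this
        linarith
      · have := hαs q ⟨r, rfl⟩ hq
        rw [mht_append] at h0 ⊢
        rw [mht_wordStar]
        linarith

theorem isSelfAdjointLang_irrMotzkinLang : IsSelfAdjointLang mstar IrrMotzkinLang := by
  intro w hw
  rw [mem_irrMotzkinLang_iff] at hw ⊢
  obtain ⟨hl, h0, h⟩ := hw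
  refine ⟨by simpa [wordStar] using hl, by rw [mht_wordStar, h0, neg_zero], fun p q hpq hp hq => ?_⟩
  have hw' : wordStar mstar q ++ wordStar mstar p = w := by
    rw [← wordStar_append, hpq, wordStar_wordStar mstar_involutive]
  have := h _ _ hw' (by simpa [wordStar_eq_nil] using hq) (by simpa [wordStar_eq_nil] using hp)
  rw [← hw', mht_append, mht_wordStar p] at h0
  linarith

/-- The language of irreducible Motzkin words is Pythagorean. -/
theorem irrMotzkin_isPythagorean : IsPythagorean mstar IrrMotzkinLang := by
  refine ⟨isSelfAdjointLang_irrMotzkinLang, fun α β γ hα hβ hγ h₁ h₂ => ?_⟩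
  rw [wordStar_append_mem_irrMotzkinLang_iff hα hβ] at h₁
  rw [wordStar_append_mem_irrMotzkinLang_iff hα hγ] at h₂
  rw [wordStar_append_mem_irrMotzkinLang_iff hα hα, wordStar_append_mem_irrMotzkinLang_iff hβ hγ]
  exact ⟨⟨rfl, h₁.2.1, h₁.2.1⟩, h₁.1.symm.trans h₂.1, h₁.2.2, h₂.2.2⟩
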